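/- arXiv:1101.4929 — 5 statements merged into one kernel-verified Lean document; each statement's English description precedes it below -/
import Mathlib

section
/- A presheaf X : 𝔽 ⥤ Type is finitely presentable (i.e., its hom-functor Hom(X, −) preserves filtered colimits) if and only if X is super-finitary. -/
open CategoryTheory CategoryTheory.Limits

/-- A presheaf (object of `𝔽 ⥤ Type`) is finitely presentable if its hom-functor
`Hom(X, −)` preserves filtered colimits. -/
def FinitelyPresentable (X : FintypeCat.{0} ⥤ Type) : Prop :=
  PreservesFilteredColimits (coyoneda.obj (Opposite.op X))

/-- A presheaf `X : 𝔽 ⥤ Type` is super-finitary if every `X(Γ)` is finite and there is a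
nonempty context `Γ₀` generating `X`: every element of `X(Γ)` for nonempty `Γ` is of the
form `X(γ)(b)` for some `γ : Γ₀ → Γ` and `b ∈ X(Γ₀)`. -/
def SuperFinitary (X : FintypeCat.{0} ⥤ Type) : Prop :=
  (∀ Γ : FintypeCat, Finite (X.obj Γ)) ∧
    ∃ Γ₀ : FintypeCat, Nonempty Γ₀ ∧
      ∀ Γ : FintypeCat, Nonempty Γ →
        ∀ a : X.obj Γ, ∃ (γ : Γ₀ ⟶ Γ) (b : X.obj Γ₀), X.map γ b = a

universe v u

/-- Finitely many conditions on morphisms out of an object `j` of a filtered category, each of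
them stable under postcomposition and eventually satisfied, are eventually satisfied
simultaneously. -/
lemma CategoryTheory.IsFiltered.exists_hom_forall_of_finite {J : Type u} [Category.{v} J]
    [IsFiltered J] {j : J}
    {ι : Type*} [Finite ι] (P : ι → ∀ k : J, (j ⟶ k) → Prop)
    (hP : ∀ i k l (u : j ⟶ k) (v : k ⟶ l), P i k u → P i l (u ≫ v))
    (h : ∀ i, ∃ k u, P i k u) : ∃ k u, ∀ i, P i k u := by
  classical
  have := Fintype.ofFinite ι
  choose k u hu using h
  obtain ⟨S, hS⟩ := IsFiltered.sup_objs_exists (Finset.univ.image fun i ↦ Under.mk (u i))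
  refine ⟨S.right, S.hom, fun i ↦ ?_⟩
  obtain ⟨f⟩ := hS (Finset.mem_image_of_mem _ (Finset.mem_univ i))
  rw [← Under.w f]
  exact hP i _ _ _ _ (hu i)

namespace CategoryTheory.Subfunctor

variable {C : Type u} [Category.{v} C] (X : C ⥤ Type v)

/-- The subfunctor of `X` generated by a finite set of elements. -/
def spanFinset (S : Finset (Σ Γ : C, X.obj Γ)) : Subfunctor X where
  obj Γ := {a | ∃ p ∈ S, ∃ γ : p.1 ⟶ Γ, X.map γ p.2 = a}
  map := by
    rintro U V i _ ⟨p, hp, γ, rfl⟩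
    exact ⟨p, hp, γ ≫ i, by simp⟩

lemma mem_spanFinset_singleton {Γ : C} (a : X.obj Γ) : a ∈ (spanFinset X {⟨Γ, a⟩}).obj Γ :=
  ⟨⟨Γ, a⟩, by simp, 𝟙 Γ, by simp⟩

lemma spanFinset_mono {S T : Finset (Σ Γ : C, X.obj Γ)} (h : S ≤ T) :
    spanFinset X S ≤ spanFinset X T := by
  rintro Γ a ⟨p, hp, γ, rfl⟩
  exact ⟨p, h hp, γ, rfl⟩

/-- The directed diagram of the finitely generated subfunctors of `X`. -/
def spanFinsetFunctor : Finset (Σ Γ : C, X.obj Γ) ⥤ C ⥤ Type v where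
  obj S := (spanFinset X S).toFunctor
  map f := homOfLe (spanFinset_mono X f.le)

/-- The cocone exhibiting `X` as the union of its finitely generated subfunctors. -/
def spanFinsetCocone : Cocone (spanFinsetFunctor X) where
  pt := X
  ι := { app S := (spanFinset X S).ι }

/-- A functor to types is the directed colimit of its finitely generated subfunctors. -/
def isColimitSpanFinsetCocone : IsColimit (spanFinsetCocone X) := by
  classical
  have key (s : Cocone (spanFinsetFunctor X)) (S : Finset (Σ Γ : C, X.obj Γ)) (Γ : C)
      (a : X.obj Γ) (ha : a ∈ (spanFinset X S).obj Γ) :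
      (s.ι.app {⟨Γ, a⟩}).app Γ ⟨a, mem_spanFinset_singleton X a⟩ = (s.ι.app S).app Γ ⟨a, ha⟩ := by
    have h₁ := s.w (homOfLE (Finset.subset_union_left : {⟨Γ, a⟩} ⊆ {⟨Γ, a⟩} ∪ S))
    have h₂ := s.w (homOfLE (Finset.subset_union_right : S ⊆ {⟨Γ, a⟩} ∪ S))
    rw [← h₁, ← h₂]
    rfl
  exact
    { desc s :=
        { app Γ := ↾fun a ↦ (s.ι.app {⟨Γ, a⟩}).app Γ ⟨a, mem_spanFinset_singleton X a⟩
          naturality Γ Δ γ := by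
            ext a
            have h := key s {⟨Γ, a⟩} Δ (X.map γ a)
              ((spanFinset X {⟨Γ, a⟩}).map γ (mem_spanFinset_singleton X a))
            exact h.trans (NatTrans.naturality_apply (s.ι.app {⟨Γ, a⟩}) γ
              ⟨a, mem_spanFinset_singleton X a⟩) }
      fac s S := by
        ext Γ a
        exact key s S Γ a.1 a.2
      uniq s m hm := by
        ext Γ a
        exact ConcreteCategory.congr_hom (NatTrans.congr_app (hm {⟨Γ, a⟩}) Γ)
          ⟨a, mem_spanFinset_singleton X a⟩ }

end CategoryTheory.Subfunctor

namespace SuperFinitary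

variable {X Y : FintypeCat.{0} ⥤ Type} {Γ₀ : FintypeCat.{0}}

/-- Every map out of a nonempty finite set has a generalized inverse. -/
lemma exists_comp_comp_eq {A B : FintypeCat.{0}} [Nonempty A] (q : A ⟶ B) :
    ∃ h : B ⟶ A, q ≫ h ≫ q = q := by
  refine ⟨FintypeCat.homMk (Function.invFun q), ?_⟩
  ext x
  exact Function.invFun_eq ⟨x, rfl⟩

/-- The unique map out of the empty finite set. -/
def fromEmpty (Γ : FintypeCat.{0}) : FintypeCat.of PEmpty.{1} ⟶ Γ :=
  FintypeCat.homMk PEmpty.elim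

lemma eq_fromEmpty {Γ : FintypeCat.{0}} (i : FintypeCat.of PEmpty.{1} ⟶ Γ) : i = fromEmpty Γ := by
  ext x
  exact x.elim

lemma map_fromEmpty_injective (X : FintypeCat.{0} ⥤ Type) {Γ : FintypeCat.{0}} [IsEmpty Γ]
    (c c' : X.obj (.of PEmpty)) (h : X.map (fromEmpty Γ) c = X.map (fromEmpty Γ) c') :
    c = c' := by
  let r : Γ ⟶ .of PEmpty.{1} := FintypeCat.homMk isEmptyElim
  have hr : fromEmpty Γ ≫ r = 𝟙 _ := by
    ext x
    exact x.elim
  have := congrArg (X.map r) h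
  simpa [← comp_apply, ← Functor.map_comp, hr] using this

lemma exists_map_fromEmpty (X : FintypeCat.{0} ⥤ Type) {Γ : FintypeCat.{0}} [IsEmpty Γ]
    (a : X.obj Γ) : ∃ c, X.map (fromEmpty Γ) c = a := by
  let r : Γ ⟶ .of PEmpty.{1} := FintypeCat.homMk isEmptyElim
  have hr : r ≫ fromEmpty Γ = 𝟙 _ := by
    ext x
    exact isEmptyElim x
  exact ⟨X.map r a, by simp [← comp_apply, ← Functor.map_comp, hr]⟩

/-- The context `Γ₀` generates `X` at all nonempty contexts. -/
def Generates (X : FintypeCat.{0} ⥤ Type) (Γ₀ : FintypeCat.{0}) : Prop :=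
  ∀ Γ : FintypeCat, Nonempty Γ → ∀ a : X.obj Γ, ∃ (γ : Γ₀ ⟶ Γ) (b : X.obj Γ₀), X.map γ b = a

lemma Generates.hom_ext (hX : Generates X Γ₀) {f g : X ⟶ Y}
    (h₀ : ∀ b, f.app Γ₀ b = g.app Γ₀ b)
    (h₁ : ∀ c, f.app (.of PEmpty) c = g.app (.of PEmpty) c) : f = g := by
  refine NatTrans.ext (funext fun Γ ↦ ConcreteCategory.hom_ext _ _ fun a ↦ ?_)
  rcases isEmpty_or_nonempty Γ with hΓ | hΓ
  · obtain ⟨c, rfl⟩ := exists_map_fromEmpty X a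
    rw [NatTrans.naturality_apply, NatTrans.naturality_apply, h₁]
  · obtain ⟨γ, b, rfl⟩ := hX Γ hΓ a
    rw [NatTrans.naturality_apply, NatTrans.naturality_apply, h₀]

/-- The relations satisfied by the generators of `X` in all nonempty contexts follow from those
in the context `Γ₀ ⊕ Γ₀`. -/
lemma map_eq_map_of_relations [Nonempty Γ₀] (φ₀ : X.obj Γ₀ → Y.obj Γ₀)
    (hrel : ∀ (γ γ' : Γ₀ ⟶ .of (Γ₀ ⊕ Γ₀)) (b b' : X.obj Γ₀), X.map γ b = X.map γ' b' →
      Y.map γ (φ₀ b) = Y.map γ' (φ₀ b'))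
    {Γ : FintypeCat.{0}} (γ γ' : Γ₀ ⟶ Γ) (b b' : X.obj Γ₀) (h : X.map γ b = X.map γ' b') :
    Y.map γ (φ₀ b) = Y.map γ' (φ₀ b') := by
  let q : FintypeCat.of (Γ₀ ⊕ Γ₀) ⟶ Γ := FintypeCat.homMk (Sum.elim γ γ')
  obtain ⟨r, hr⟩ := exists_comp_comp_eq q
  have hγ : γ ≫ r ≫ q = γ := by
    ext x
    exact ConcreteCategory.congr_hom hr (Sum.inl x)
  have hγ' : γ' ≫ r ≫ q = γ' := by
    ext x
    exact ConcreteCategory.congr_hom hr (Sum.inr x)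
  have := congrArg (Y.map q) (hrel (γ ≫ r) (γ' ≫ r) b b' (by simp [h]))
  simpa [← comp_apply, ← Functor.map_comp, hγ, hγ'] using this

/-- A natural transformation out of `X` can be prescribed on the generators in `Γ₀` and on the
empty context, provided that finitely many relations are respected. -/
lemma Generates.exists_hom [Nonempty Γ₀] (hX : Generates X Γ₀) (φ₀ : X.obj Γ₀ → Y.obj Γ₀)
    (φ₁ : X.obj (.of PEmpty) → Y.obj (.of PEmpty))
    (hφ : ∀ c, Y.map (fromEmpty Γ₀) (φ₁ c) = φ₀ (X.map (fromEmpty Γ₀) c))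
    (hrel : ∀ (γ γ' : Γ₀ ⟶ .of (Γ₀ ⊕ Γ₀)) (b b' : X.obj Γ₀), X.map γ b = X.map γ' b' →
      Y.map γ (φ₀ b) = Y.map γ' (φ₀ b')) :
    ∃ f : X ⟶ Y, (∀ b, f.app Γ₀ b = φ₀ b) ∧ ∀ c, f.app (.of PEmpty) c = φ₁ c := by
  let G (Γ : FintypeCat.{0}) (a : X.obj Γ) (y : Y.obj Γ) : Prop :=
    (∃ (γ : Γ₀ ⟶ Γ) (b : X.obj Γ₀), X.map γ b = a ∧ Y.map γ (φ₀ b) = y) ∨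
      (IsEmpty Γ ∧ ∃ c, X.map (fromEmpty Γ) c = a ∧ Y.map (fromEmpty Γ) (φ₁ c) = y)
  have hGempty (Γ : FintypeCat.{0}) (c : X.obj (.of PEmpty)) :
      G Γ (X.map (fromEmpty Γ) c) (Y.map (fromEmpty Γ) (φ₁ c)) := by
    rcases isEmpty_or_nonempty Γ with hΓ | ⟨⟨x⟩⟩
    · exact .inr ⟨hΓ, c, rfl, rfl⟩
    · let γ : Γ₀ ⟶ Γ := FintypeCat.homMk fun _ ↦ x
      refine .inl ⟨γ, X.map (fromEmpty Γ₀) c, ?_, ?_⟩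
      · rw [← eq_fromEmpty (fromEmpty Γ₀ ≫ γ)]
        simp
      · rw [← eq_fromEmpty (fromEmpty Γ₀ ≫ γ), ← hφ]
        simp
  have hGmap {Γ Δ : FintypeCat.{0}} (δ : Γ ⟶ Δ) {a : X.obj Γ} {y : Y.obj Γ} (h : G Γ a y) :
      G Δ (X.map δ a) (Y.map δ y) := by
    rcases h with ⟨γ, b, rfl, rfl⟩ | ⟨_, c, rfl, rfl⟩
    · exact .inl ⟨γ ≫ δ, b, by simp, by simp⟩
    · have := hGempty Δ c
      rw [← eq_fromEmpty (fromEmpty Γ ≫ δ)] at this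
      simpa using this
  have hGtotal (Γ : FintypeCat.{0}) (a : X.obj Γ) : ∃ y, G Γ a y := by
    rcases isEmpty_or_nonempty Γ with hΓ | hΓ
    · obtain ⟨c, rfl⟩ := exists_map_fromEmpty X a
      exact ⟨_, hGempty Γ c⟩
    · obtain ⟨γ, b, rfl⟩ := hX Γ hΓ a
      exact ⟨_, .inl ⟨γ, b, rfl, rfl⟩⟩
  have hGunique {Γ : FintypeCat.{0}} {a : X.obj Γ} {y y' : Y.obj Γ} (h : G Γ a y)
      (h' : G Γ a y') : y = y' := by
    rcases h with ⟨γ, b, rfl, rfl⟩ | ⟨hΓ, c, rfl, rfl⟩ <;>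
      rcases h' with ⟨γ', b', hb, rfl⟩ | ⟨hΓ', c', hc, rfl⟩
    · exact map_eq_map_of_relations φ₀ hrel γ γ' b b' hb.symm
    · exact (hΓ'.false (γ (Classical.arbitrary Γ₀))).elim
    · exact (hΓ.false (γ' (Classical.arbitrary Γ₀))).elim
    · rw [map_fromEmpty_injective X _ _ hc]
  choose y hy using hGtotal
  refine ⟨{ app Γ := ↾y Γ, naturality Γ Δ δ := ?_ }, fun b ↦ ?_, fun c ↦ ?_⟩
  · ext a
    exact hGunique (hy Δ (X.map δ a)) (hGmap δ (hy Γ a))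
  · exact hGunique (hy Γ₀ b) (.inl ⟨𝟙 _, b, by simp, by simp⟩)
  · refine hGunique (hy _ c) ?_
    have := hGempty (.of PEmpty) c
    rw [← eq_fromEmpty (𝟙 _)] at this
    simpa using this

section Colimits

universe v' u'

variable {J : Type u'} [Category.{v'} J] {D : J ⥤ FintypeCat.{0} ⥤ Type}
  {c : Cocone D}

/-- Colimits in `FintypeCat ⥤ Type` are computed pointwise, whatever their size: evaluation
functors are left adjoints. -/
noncomputable def isColimitEvaluation (hc : IsColimit c) (Γ : FintypeCat.{0}) :
    IsColimit (((evaluation FintypeCat.{0} Type).obj Γ).mapCocone c) :=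
  isColimitOfPreserves _ hc

lemma exists_app_eq (hc : IsColimit c) {Γ : FintypeCat.{0}} (x : c.pt.obj Γ) :
    ∃ j y, (c.ι.app j).app Γ y = x :=
  Types.jointly_surjective_of_isColimit (isColimitEvaluation hc Γ) x

variable [IsFiltered J]

lemma exists_map_app_eq (hc : IsColimit c) {Γ : FintypeCat.{0}} {j : J} (x y : (D.obj j).obj Γ)
    (h : (c.ι.app j).app Γ x = (c.ι.app j).app Γ y) :
    ∃ (k : J) (u : j ⟶ k), (D.map u).app Γ x = (D.map u).app Γ y :=
  (Types.FilteredColimit.isColimit_eq_iff' (isColimitEvaluation hc Γ) x y).1 h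

lemma exists_forall_app_eq (hc : IsColimit c) {ι : Type} [Finite ι] (Γ : ι → FintypeCat.{0})
    (x : ∀ i, c.pt.obj (Γ i)) :
    ∃ (j : J) (y : ∀ i, (D.obj j).obj (Γ i)), ∀ i, (c.ι.app j).app (Γ i) (y i) = x i := by
  classical
  have := Fintype.ofFinite ι
  choose j y hy using fun i ↦ exists_app_eq hc (x i)
  obtain ⟨k, hk⟩ := IsFiltered.sup_objs_exists (Finset.univ.image j)
  have u (i : ι) : j i ⟶ k := (hk (Finset.mem_image_of_mem _ (Finset.mem_univ i))).some
  refine ⟨k, fun i ↦ (D.map (u i)).app (Γ i) (y i), fun i ↦ ?_⟩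
  rw [← hy i, ← c.w (u i)]
  rfl

lemma exists_forall_map_app_eq (hc : IsColimit c) {ι : Type} [Finite ι]
    (Γ : ι → FintypeCat.{0}) {j : J} (x y : ∀ i, (D.obj j).obj (Γ i))
    (h : ∀ i, (c.ι.app j).app (Γ i) (x i) = (c.ι.app j).app (Γ i) (y i)) :
    ∃ (k : J) (u : j ⟶ k), ∀ i, (D.map u).app (Γ i) (x i) = (D.map u).app (Γ i) (y i) := by
  refine IsFiltered.exists_hom_forall_of_finite
    (fun i k (u : j ⟶ k) ↦ (D.map u).app (Γ i) (x i) = (D.map u).app (Γ i) (y i)) ?_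
    fun i ↦ exists_map_app_eq hc _ _ (h i)
  intro i k l u v h
  simp [h]

variable [Finite (X.obj Γ₀)] [Finite (X.obj (.of PEmpty))]

lemma Generates.exists_factorization [Nonempty Γ₀] (hX : Generates X Γ₀) (hc : IsColimit c)
    (f : X ⟶ c.pt) :
    ∃ (j : J) (g : X ⟶ D.obj j), g ≫ c.ι.app j = f := by
  let ctx : X.obj Γ₀ ⊕ X.obj (.of PEmpty) → FintypeCat.{0} :=
    Sum.elim (fun _ ↦ Γ₀) (fun _ ↦ .of PEmpty)
  obtain ⟨j, y, hy⟩ := exists_forall_app_eq hc ctx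
    (Sum.rec (fun b ↦ f.app Γ₀ b) (fun e ↦ f.app (.of PEmpty) e))
  let y₀ (b : X.obj Γ₀) : (D.obj j).obj Γ₀ := y (.inl b)
  let y₁ (e : X.obj (.of PEmpty)) : (D.obj j).obj (.of PEmpty) := y (.inr e)
  have hy₀ (b) : (c.ι.app j).app Γ₀ (y₀ b) = f.app Γ₀ b := hy (.inl b)
  have hy₁ (e) : (c.ι.app j).app (.of PEmpty) (y₁ e) = f.app (.of PEmpty) e := hy (.inr e)
  obtain ⟨k, u, hu⟩ := exists_forall_map_app_eq hc (fun _ ↦ Γ₀)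
    (fun e ↦ (D.obj j).map (fromEmpty Γ₀) (y₁ e)) (fun e ↦ y₀ (X.map (fromEmpty Γ₀) e))
    (fun e ↦ by
      rw [NatTrans.naturality_apply, hy₀, hy₁, NatTrans.naturality_apply]
      rfl)
  let Rel := {r : ((Γ₀ ⟶ .of (Γ₀ ⊕ Γ₀)) × (Γ₀ ⟶ .of (Γ₀ ⊕ Γ₀))) × (X.obj Γ₀ × X.obj Γ₀) //
    X.map r.1.1 r.2.1 = X.map r.1.2 r.2.2}
  obtain ⟨l, v, hv⟩ := exists_forall_map_app_eq hc (ι := Rel) (fun _ ↦ .of (Γ₀ ⊕ Γ₀))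
    (fun r ↦ (D.obj k).map r.1.1.1 ((D.map u).app Γ₀ (y₀ r.1.2.1)))
    (fun r ↦ (D.obj k).map r.1.1.2 ((D.map u).app Γ₀ (y₀ r.1.2.2)))
    (fun r ↦ by
      have hw (b) : (c.ι.app k).app Γ₀ ((D.map u).app Γ₀ (y₀ b)) = f.app Γ₀ b := by
        rw [← hy₀, ← c.w u]
        rfl
      rw [NatTrans.naturality_apply, NatTrans.naturality_apply, hw, hw,
        ← NatTrans.naturality_apply, ← NatTrans.naturality_apply, r.2])
  obtain ⟨g, hg₀, hg₁⟩ := hX.exists_hom (Y := D.obj l) (fun b ↦ (D.map (u ≫ v)).app Γ₀ (y₀ b))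
    (fun e ↦ (D.map (u ≫ v)).app (.of PEmpty) (y₁ e))
    (fun e ↦ by
      rw [← NatTrans.naturality_apply]
      simp [hu])
    (fun γ γ' b b' h ↦ by
      simpa [NatTrans.naturality_apply] using hv ⟨((γ, γ'), (b, b')), h⟩)
  refine ⟨l, g, hX.hom_ext (fun b ↦ ?_) fun e ↦ ?_⟩
  · rw [← hy₀, ← c.w (u ≫ v)]
    exact congrArg ((c.ι.app l).app Γ₀) (hg₀ b)
  · rw [← hy₁, ← c.w (u ≫ v)]
    exact congrArg ((c.ι.app l).app (.of PEmpty)) (hg₁ e)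

lemma Generates.exists_comp_map_eq (hX : Generates X Γ₀) (hc : IsColimit c) {j : J}
    (f g : X ⟶ D.obj j) (h : f ≫ c.ι.app j = g ≫ c.ι.app j) :
    ∃ (k : J) (u : j ⟶ k), f ≫ D.map u = g ≫ D.map u := by
  let ctx : X.obj Γ₀ ⊕ X.obj (.of PEmpty) → FintypeCat.{0} :=
    Sum.elim (fun _ ↦ Γ₀) (fun _ ↦ .of PEmpty)
  have happ (Γ : FintypeCat.{0}) (a : X.obj Γ) :
      (c.ι.app j).app Γ (f.app Γ a) = (c.ι.app j).app Γ (g.app Γ a) :=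
    ConcreteCategory.congr_hom (NatTrans.congr_app h Γ) a
  obtain ⟨k, u, hu⟩ := exists_forall_map_app_eq hc ctx
    (Sum.rec (fun b ↦ f.app Γ₀ b) (fun e ↦ f.app (.of PEmpty) e))
    (Sum.rec (fun b ↦ g.app Γ₀ b) (fun e ↦ g.app (.of PEmpty) e))
    (Sum.rec (fun b ↦ happ _ b) (fun e ↦ happ _ e))
  exact ⟨k, u, hX.hom_ext (fun b ↦ hu (.inl b)) fun e ↦ hu (.inr e)⟩

end Colimits

lemma finitelyPresentable (h : SuperFinitary X) : FinitelyPresentable X := by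
  obtain ⟨_, Γ₀, _, hX⟩ := h
  replace hX : Generates X Γ₀ := hX
  refine ⟨fun J _ _ ↦ ⟨fun {D} ↦ ⟨fun {c} hc ↦ ⟨?_⟩⟩⟩⟩
  refine Types.FilteredColimit.isColimitOf' _ _ (fun f ↦ ?_) fun j f g h ↦ ?_
  · obtain ⟨j, g, hg⟩ := hX.exists_factorization hc f
    exact ⟨j, g, hg.symm⟩
  · exact hX.exists_comp_map_eq hc f g h

end SuperFinitary

/-- A finitely presentable presheaf is generated by finitely many elements. -/
lemma FinitelyPresentable.exists_generators {X : FintypeCat.{0} ⥤ Type}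
    (h : FinitelyPresentable X) :
    ∃ (n : ℕ) (Δ : Fin n → FintypeCat.{0}) (x : ∀ i, X.obj (Δ i)),
      ∀ (Γ : FintypeCat.{0}) (a : X.obj Γ), ∃ (i : Fin n) (γ : Δ i ⟶ Γ), X.map γ (x i) = a := by
  have : PreservesFilteredColimits (coyoneda.obj (Opposite.op X)) := h
  obtain ⟨S, g, hg⟩ : ∃ (S : Finset (Σ Γ, X.obj Γ))
      (g : X ⟶ (Subfunctor.spanFinset X S).toFunctor),
      g ≫ (Subfunctor.spanFinset X S).ι = 𝟙 X :=
    exists_hom_of_preservesColimit_coyoneda (Subfunctor.isColimitSpanFinsetCocone X) (𝟙 X)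
  refine ⟨S.card, fun i ↦ (S.equivFin.symm i).1.1, fun i ↦ (S.equivFin.symm i).1.2,
    fun Γ a ↦ ?_⟩
  have ha : (g.app Γ a).1 = a := by
    have := ConcreteCategory.congr_hom (NatTrans.congr_app hg Γ) a
    simpa using this
  obtain ⟨p, hp, γ, hγ⟩ := (g.app Γ a).2
  obtain ⟨i, hi⟩ := S.equivFin.symm.surjective ⟨p, hp⟩
  obtain rfl : (S.equivFin.symm i).1 = p := congrArg Subtype.val hi
  exact ⟨i, γ, hγ.trans ha⟩

lemma FinitelyPresentable.superFinitary {X : FintypeCat.{0} ⥤ Type}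
    (h : FinitelyPresentable X) : SuperFinitary X := by
  obtain ⟨n, Δ, x, hx⟩ := h.exists_generators
  refine ⟨fun Γ ↦ ?_, .of (Option (Σ i, Δ i)), ⟨none⟩, fun Γ ⟨z⟩ a ↦ ?_⟩
  · refine Finite.of_surjective (fun q : Σ i, (Δ i ⟶ Γ) ↦ X.map q.2 (x q.1)) fun a ↦ ?_
    obtain ⟨i, γ, rfl⟩ := hx Γ a
    exact ⟨⟨i, γ⟩, rfl⟩
  · obtain ⟨i, γ, rfl⟩ := hx Γ a
    let s : Δ i ⟶ .of (Option (Σ i, Δ i)) := FintypeCat.homMk fun y ↦ some ⟨i, y⟩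
    let r : .of (Option (Σ i, Δ i)) ⟶ Γ := FintypeCat.homMk fun o ↦
      o.elim z fun q ↦ if h : q.1 = i then γ (h ▸ q.2) else z
    have hsr : s ≫ r = γ := by
      ext y
      exact dif_pos rfl
    exact ⟨r, X.map s (x i), by rw [← hsr]; simp⟩

/-- A presheaf in `𝔽 ⥤ Type` is finitely presentable iff it is super-finitary. -/
theorem finitelyPresentable_iff_superFinitary (X : FintypeCat.{0} ⥤ Type) :
    FinitelyPresentable X ↔ SuperFinitary X :=
  ⟨FinitelyPresentable.superFinitary, SuperFinitary.finitelyPresentable⟩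
end

section
/- Every super-finitary presheaf X : 𝔽 ⥤ Type is the colimit of a diagram of representable presheaves 𝔽(Γ, −) indexed by a finite category; in particular, X is a finite colimit of representable presheaves. -/
open CategoryTheory CategoryTheory.Limits

/-- A presentation of the presheaf `X` as a colimit, over a finite index category, of a
diagram all of whose objects are representable presheaves `𝔽(Γ, −)`. -/
structure FiniteRepresentableColimitPresentation (X : FintypeCat.{0} ⥤ Type) where
  /-- the (finite) index category -/
  J : Type
  [instCat : SmallCategory J]
  [instFin : FinCategory J]
  /-- the diagram -/
  D : J ⥤ (FintypeCat.{0} ⥤ Type)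
  /-- every object of the diagram is a representable presheaf `𝔽(Γ, −)` -/
  representable : ∀ j : J, ∃ Γ : FintypeCat, Nonempty (D.obj j ≅ coyoneda.obj (Opposite.op Γ))
  /-- a cocone over the diagram with apex `X` ... -/
  ι : D ⟶ (Functor.const J).obj X
  /-- ... which is a colimit cocone -/
  isColimit : IsColimit (Cocone.mk X ι)

namespace SuperFinitary

/-- The standard finite set with `n` elements. -/
abbrev stdContext (n : ℕ) : FintypeCat.{0} := FintypeCat.of (Fin n)

/-- Two maps out of an `n`-element set, `n > 0`, factor through a common split monomorphism
whose source has at most `n + n` elements. -/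
lemma exists_common_split_mono_factorization {n : ℕ} {Δ : FintypeCat.{0}}
    (hn : 0 < n) (g g' : stdContext n ⟶ Δ) :
    ∃ m ≤ n + n, ∃ (i : stdContext m ⟶ Δ) (r : Δ ⟶ stdContext m)
      (p p' : stdContext n ⟶ stdContext m),
      i ≫ r = 𝟙 _ ∧ p ≫ i = g ∧ p' ≫ i = g' := by
  let s : Fin n ⊕ Fin n → Δ := Sum.elim (fun x ↦ g x) (fun x ↦ g' x)
  have e : Set.range s ≃ Fin (Nat.card (Set.range s)) := Finite.equivFin _
  have hcard : Nat.card (Set.range s) ≤ n + n := by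
    simpa using Finite.card_range_le s
  let v : Fin (Nat.card (Set.range s)) → Δ := fun x ↦ (e.symm x).1
  have hv : Function.Injective v := Subtype.val_injective.comp e.symm.injective
  have : Nonempty (Fin (Nat.card (Set.range s))) := ⟨e ⟨_, Sum.inl ⟨0, hn⟩, rfl⟩⟩
  refine ⟨_, hcard, FintypeCat.homMk v, FintypeCat.homMk (Function.invFun v),
    FintypeCat.homMk fun x ↦ e ⟨g x, Sum.inl x, rfl⟩,
    FintypeCat.homMk fun x ↦ e ⟨g' x, Sum.inr x, rfl⟩, ?_, ?_, ?_⟩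
  · refine FintypeCat.hom_ext _ _ fun x ↦ ?_
    exact Function.leftInverse_invFun hv x
  · refine FintypeCat.hom_ext _ _ fun x ↦ ?_
    exact congrArg Subtype.val (e.symm_apply_apply _)
  · refine FintypeCat.hom_ext _ _ fun x ↦ ?_
    exact congrArg Subtype.val (e.symm_apply_apply _)

section Extension

/-- Every element of `X` over a nonempty context comes from the standard context with `n`
elements. -/
def IsGeneratedAt (X : FintypeCat.{0} ⥤ Type) (n : ℕ) : Prop :=
  ∀ Γ : FintypeCat.{0}, Nonempty Γ → ∀ a : X.obj Γ,
    ∃ (γ : stdContext n ⟶ Γ) (b : X.obj (stdContext n)), X.map γ b = a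

/-- A family of maps on standard contexts with at most `N` elements is natural. -/
def IsNaturalUpTo {X Y : FintypeCat.{0} ⥤ Type} {N : ℕ}
    (t : ∀ k, k ≤ N → X.obj (stdContext k) → Y.obj (stdContext k)) : Prop :=
  ∀ k hk k' hk' (f : stdContext k ⟶ stdContext k') x,
    Y.map f (t k hk x) = t k' hk' (X.map f x)

variable {X Y : FintypeCat.{0} ⥤ Type} {n : ℕ}
  {t : ∀ k, k ≤ n + n → X.obj (stdContext k) → Y.obj (stdContext k)}

/-- Every pair of an element in a small context and a map to a nonempty set can be replaced by
a pair in the generating context. -/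
lemma exists_generator_pair (hgen : IsGeneratedAt X n) (ht : IsNaturalUpTo t)
    (hn : 0 < n) {Δ : FintypeCat.{0}} [Nonempty Δ] {k : ℕ} (hk : k ≤ n + n)
    (x : X.obj (stdContext k)) (f : stdContext k ⟶ Δ) :
    ∃ (g : stdContext n ⟶ Δ) (b : X.obj (stdContext n)),
      X.map g b = X.map f x ∧ Y.map g (t n (by omega) b) = Y.map f (t k hk x) := by
  obtain ⟨k', hk', hpos, q, f', rfl⟩ : ∃ k' ≤ n + n, 0 < k' ∧
      ∃ (q : stdContext k ⟶ stdContext k') (f' : stdContext k' ⟶ Δ), q ≫ f' = f := by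
    rcases Nat.eq_zero_or_pos k with rfl | hpos
    · refine ⟨1, by omega, one_pos, FintypeCat.homMk fun _ ↦ 0,
        FintypeCat.homMk fun _ ↦ Classical.arbitrary Δ, ?_⟩
      ext x
      exact Fin.elim0 x
    · exact ⟨k, hk, hpos, 𝟙 _, f, Category.id_comp f⟩
  obtain ⟨γ, b, hb⟩ := hgen (stdContext k') ⟨(⟨0, hpos⟩ : Fin k')⟩ (X.map q x)
  refine ⟨γ ≫ f', b, ?_, ?_⟩
  · simp [hb]
  · simp [ht n _ k' hk', ht k hk k' hk', hb]

/-- The value at `X.map f x` of an extension of `t` does not depend on the choice of `f` and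
`x`. -/
lemma map_eq_of_map_eq (hgen : IsGeneratedAt X n) (ht : IsNaturalUpTo t) (hn : 0 < n)
    {Δ : FintypeCat.{0}} {k k' : ℕ} (hk : k ≤ n + n) (hk' : k' ≤ n + n)
    (x : X.obj (stdContext k)) (x' : X.obj (stdContext k'))
    (f : stdContext k ⟶ Δ) (f' : stdContext k' ⟶ Δ) (h : X.map f x = X.map f' x') :
    Y.map f (t k hk x) = Y.map f' (t k' hk' x') := by
  rcases isEmpty_or_nonempty Δ with hΔ | hΔ
  · let r : Δ ⟶ stdContext k := FintypeCat.homMk fun d ↦ hΔ.elim d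
    have hr : f ≫ r = 𝟙 _ := by
      ext y
      exact hΔ.elim (f y)
    have hr' : f' ≫ r ≫ f = f' := by
      ext y
      exact hΔ.elim (f' y)
    have hx : x = X.map (f' ≫ r) x' := by
      have := congrArg (X.map r) h
      rw [← Functor.map_comp_apply, ← Functor.map_comp_apply, hr] at this
      simpa using this
    rw [hx, ← ht k' hk' k hk, ← Functor.map_comp_apply, Category.assoc, hr']
  · obtain ⟨g, b, hb, hb'⟩ := exists_generator_pair hgen ht hn hk x f
    obtain ⟨g', c, hc, hc'⟩ := exists_generator_pair hgen ht hn hk' x' f'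
    rw [← hb', ← hc']
    obtain ⟨m, hm, i, r, p, p', hir, rfl, rfl⟩ := exists_common_split_mono_factorization hn g g'
    have hpp : X.map p b = X.map p' c := by
      have := congrArg (X.map r) (hb.trans (h.trans hc.symm))
      simp only [← Functor.map_comp_apply, Category.assoc, hir, Category.comp_id] at this
      exact this
    simp only [Functor.map_comp_apply, ht n _ m hm, hpp]

/-- Every element comes from a context with at most `n + n` elements. -/
lemma exists_small_representative (hgen : IsGeneratedAt X n) (Δ : FintypeCat.{0})
    (a : X.obj Δ) :
    ∃ (k : ℕ) (_ : k ≤ n + n) (x : X.obj (stdContext k)) (f : stdContext k ⟶ Δ),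
      X.map f x = a := by
  rcases isEmpty_or_nonempty Δ with hΔ | hΔ
  · let r : Δ ⟶ stdContext 0 := FintypeCat.homMk fun d ↦ hΔ.elim d
    refine ⟨0, by omega, X.map r a, FintypeCat.homMk fun y : Fin 0 ↦ y.elim0, ?_⟩
    rw [← Functor.map_comp_apply]
    convert Functor.map_id_apply X Δ a
    ext y
    exact hΔ.elim y
  · obtain ⟨γ, b, hb⟩ := hgen Δ hΔ a
    exact ⟨n, by omega, b, γ, hb⟩

/-- A transformation defined on contexts with at most `n + n` elements extends to all
contexts. -/
lemma exists_extension (hgen : IsGeneratedAt X n) (ht : IsNaturalUpTo t) (hn : 0 < n) :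
    ∃ φ : X ⟶ Y, ∀ k hk x, φ.app (stdContext k) x = t k hk x := by
  choose k hk x f hf using exists_small_representative hgen
  have key (Δ : FintypeCat.{0}) (j : ℕ) (hj : j ≤ n + n) (y : X.obj (stdContext j))
      (g : stdContext j ⟶ Δ) (a : X.obj Δ) (hg : X.map g y = a) :
      Y.map (f Δ a) (t _ (hk Δ a) (x Δ a)) = Y.map g (t j hj y) :=
    map_eq_of_map_eq hgen ht hn _ _ _ _ _ _ ((hf Δ a).trans hg.symm)
  refine ⟨{ app := fun Δ ↦ ↾fun a ↦ Y.map (f Δ a) (t _ (hk Δ a) (x Δ a)), naturality := ?_ }, ?_⟩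
  · intro Δ Δ' γ
    ext a
    have := key Δ' _ (hk Δ a) (x Δ a) (f Δ a ≫ γ) (X.map γ a)
      (by rw [Functor.map_comp_apply, hf])
    simpa using this
  · intro j hj y
    simpa using key (stdContext j) j hj y (𝟙 _) y (by simp)

/-- Natural transformations out of `X` are determined by contexts with at most `n + n`
elements. -/
lemma hom_ext_of_small (hgen : IsGeneratedAt X n) {φ ψ : X ⟶ Y}
    (h : ∀ k, k ≤ n + n → ∀ x : X.obj (stdContext k),
      φ.app (stdContext k) x = ψ.app (stdContext k) x) : φ = ψ := by
  ext Δ a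
  obtain ⟨k, hk, x, f, rfl⟩ := exists_small_representative hgen Δ a
  change φ.app Δ (X.map f x) = ψ.app Δ (X.map f x)
  rw [NatTrans.naturality_apply, NatTrans.naturality_apply, h k hk x]

end Extension

section Presentation

variable (X : FintypeCat.{0} ⥤ Type) (N : ℕ)

/-- An element of `X` over a standard context with at most `N` elements, viewed in the category
of elements of `X`. -/
def toElements (p : Σ k : Fin (N + 1), X.obj (stdContext k)) : X.Elements :=
  X.elementsMk (stdContext p.1) p.2

/-- The category of elements of `X` over the standard contexts with at most `N` elements. -/
abbrev SmallElements := InducedCategory X.Elements (toElements X N)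

noncomputable instance [∀ Γ, Finite (X.obj Γ)] : FinCategory (SmallElements X N) where
  fintypeObj := @Fintype.ofFinite _
    (inferInstanceAs (Finite (Σ k : Fin (N + 1), X.obj (stdContext k))))
  fintypeHom p q := @Fintype.ofFinite _ <|
    Finite.of_injective (fun f : p ⟶ q ↦ f.hom.val) fun _ _ h ↦
      InducedCategory.hom_ext (Subtype.ext h)

/-- The diagram of representables indexed by the small elements of `X`. -/
abbrev smallDiagram : (SmallElements X N)ᵒᵖ ⥤ (FintypeCat.{0} ⥤ Type) :=
  (inducedFunctor (toElements X N) ⋙ CategoryOfElements.π X).op ⋙ coyoneda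

/-- The tautological cocone over the diagram of small elements of `X`. -/
def smallCocone : smallDiagram X N ⟶ (Functor.const _).obj X where
  app p := coyonedaEquiv.symm p.unop.2
  naturality p q f := by
    have := coyonedaEquiv_symm_map f.unop.hom.val (F := X) q.unop.2
    have h2 : X.map f.unop.hom.val q.unop.2 = p.unop.2 := f.unop.hom.2
    rw [h2] at this
    exact this.symm

variable {X} in
/-- If `X` is generated by a nonempty context with `n` elements, then it is the colimit of its
elements over contexts with at most `n + n` elements. -/
noncomputable def smallCoconeIsColimit {n : ℕ} (hgen : IsGeneratedAt X n) (hn : 0 < n) :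
    IsColimit (Cocone.mk X (smallCocone X (n + n))) := by
  let ix (k : ℕ) (hk : k ≤ n + n) (x : X.obj (stdContext k)) : SmallElements X (n + n) :=
    ⟨⟨k, Nat.lt_succ_of_le hk⟩, x⟩
  have ext (s : Cocone (smallDiagram X (n + n))) :
      ∃ φ : X ⟶ s.pt, ∀ k hk x, φ.app (stdContext k) x =
        coyonedaEquiv (X := stdContext k) (s.ι.app (.op (ix k hk x))) := by
    refine exists_extension hgen (fun k hk k' hk' f x ↦ ?_) hn
    have w := s.w (InducedCategory.homMk
      (CategoryOfElements.homMk _ _ f rfl) : ix k hk x ⟶ ix k' hk' (X.map f x)).op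
    exact (coyonedaEquiv_naturality _ _).trans (congrArg (coyonedaEquiv (X := stdContext k')) w)
  choose φ hφ using ext
  refine
    { desc := φ
      fac := fun s p ↦ ?_
      uniq := fun s m hm ↦ hom_ext_of_small hgen fun k hk x ↦ ?_ }
  · apply (coyonedaEquiv (X := stdContext p.unop.1)).injective
    refine Eq.trans ?_ (hφ s p.unop.1 (Nat.le_of_lt_succ p.unop.1.2) p.unop.2)
    exact congrArg ((φ s).app _) ((coyonedaEquiv (F := X)).apply_symm_apply p.unop.2)
  · rw [hφ s k hk x, ← hm]
    exact congrArg (m.app _) ((coyonedaEquiv (F := X)).apply_symm_apply x).symm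

end Presentation

end SuperFinitary

open SuperFinitary in
/-- Every super-finitary presheaf is a finite colimit of representable presheaves. -/
theorem superFinitary_isFiniteColimitOfRepresentables (X : FintypeCat.{0} ⥤ Type)
    (h : SuperFinitary X) : Nonempty (FiniteRepresentableColimitPresentation X) := by
  obtain ⟨hfin, Γ₀, hΓ₀, hgen⟩ := h
  obtain ⟨n, ⟨e⟩⟩ := Finite.exists_equiv_fin Γ₀
  have hn : 0 < n := Fin.pos_iff_nonempty.mpr (e.nonempty_congr.mp hΓ₀)
  let i : Γ₀ ≅ stdContext n := FintypeCat.equivEquivIso e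
  have hgen' : IsGeneratedAt X n := by
    intro Γ hΓ a
    obtain ⟨γ, b, rfl⟩ := hgen Γ hΓ a
    exact ⟨i.inv ≫ γ, X.map i.hom b, by simp [← Functor.map_comp_apply]⟩
  exact ⟨{
    J := (SmallElements X (n + n))ᵒᵖ
    D := smallDiagram X (n + n)
    representable := fun j ↦ ⟨stdContext j.unop.1, ⟨Iso.refl _⟩⟩
    ι := smallCocone X (n + n)
    isColimit := smallCoconeIsColimit hgen' hn }⟩
end

section
/- If a presheaf X : 𝔽 ⥤ Type is finitely presentable, then X(Γ) is a finite set for every finite set Γ. -/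
open CategoryTheory CategoryTheory.Limits

namespace CategoryTheory.Subfunctor

universe w v u

variable {C : Type u} [Category.{v} C] (F : C ⥤ Type w)

/-- The poset of subfunctors of `F` all of whose values are finite sets. -/
abbrev PointwiseFinite : Type (max u w) :=
  { G : Subfunctor F // ∀ U, (G.obj U).Finite }

namespace PointwiseFinite

instance : Nonempty (PointwiseFinite F) :=
  ⟨⟨⊥, fun _ ↦ Set.finite_empty⟩⟩

instance : IsDirectedOrder (PointwiseFinite F) where
  directed G H :=
    ⟨⟨G.1 ⊔ H.1, fun U ↦ (G.2 U).union (H.2 U)⟩,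
      (le_sup_left : G.1 ≤ G.1 ⊔ H.1), (le_sup_right : H.1 ≤ G.1 ⊔ H.1)⟩

/-- The diagram of all pointwise finite subfunctors of `F`. -/
@[simps]
def diagram : PointwiseFinite F ⥤ C ⥤ Type w where
  obj G := G.1.toFunctor
  map f := homOfLe (leOfHom f)

/-- The cocone exhibiting `F` as the union of its pointwise finite subfunctors. -/
@[simps]
def cocone : Cocone (diagram F) where
  pt := F
  ι := { app G := G.1.ι }

variable {F}

/-- If hom-sets are finite, every section lies in a pointwise finite subfunctor. -/
lemma exists_mem [∀ U V : C, Finite (U ⟶ V)] {U : C} (x : F.obj U) :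
    ∃ G : PointwiseFinite F, x ∈ G.1.obj U := by
  let G : Subfunctor F :=
    { obj V := Set.range fun f : U ⟶ V ↦ F.map f x
      map := by
        rintro V W g _ ⟨f, rfl⟩
        exact ⟨f ≫ g, by simp⟩ }
  exact ⟨⟨G, fun _ ↦ Set.finite_range _⟩, 𝟙 U, by simp⟩

variable (F)

/-- If hom-sets are finite, `F` is the colimit of its pointwise finite subfunctors. -/
noncomputable def isColimitCocone [∀ U V : C, Finite (U ⟶ V)] : IsColimit (cocone F) :=
  evaluationJointlyReflectsColimits _ fun U ↦
    Types.FilteredColimit.isColimitOf' _ _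
      (fun x ↦ by
        obtain ⟨G, hG⟩ := exists_mem x
        exact ⟨G, ⟨x, hG⟩, rfl⟩)
      (fun G x y h ↦ ⟨G, 𝟙 G, by
        have : x = y := Subtype.ext h
        rw [this]⟩)

end PointwiseFinite

end CategoryTheory.Subfunctor

/-- If a presheaf `X : 𝔽 ⥤ Type` is finitely presentable, then `X(Γ)` is a finite set for
every finite set `Γ`. -/
theorem finite_of_finitelyPresentable (X : FintypeCat.{0} ⥤ Type)
    (h : FinitelyPresentable X) : ∀ Γ : FintypeCat, Finite (X.obj Γ) := by
  intro Γ
  have : IsFinitelyPresentable.{1} X :=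
    isFinitelyPresentable_iff_preservesFilteredColimits.2 h
  obtain ⟨G, (p : X ⟶ G.1.toFunctor), (hp : p ≫ G.1.ι = 𝟙 X)⟩ :=
    IsFinitelyPresentable.exists_hom_of_isColimit
      (Subfunctor.PointwiseFinite.isColimitCocone X) (𝟙 X)
  refine Set.finite_univ_iff.1 ((G.2 Γ).subset fun x _ ↦ ?_)
  have hx : (p.app Γ x).1 = x := by
    simpa using ConcreteCategory.congr_hom (NatTrans.congr_app hp Γ) x
  exact hx ▸ (p.app Γ x).2
end

section
/- If X : 𝔽 ⥤ Type is a finitely presentable presheaf and q : X ⟶ Y is an epimorphism in the functor category 𝔽 ⥤ Type, then Y is finitely presentable. -/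
open CategoryTheory CategoryTheory.Limits

namespace CategoryTheory

universe v u w

namespace Subfunctor

variable {C : Type u} [Category.{v} C] {F : C ⥤ Type w}

/-- The subfunctor generated by a set of elements of a functor to types. -/
def generatedBy (F : C ⥤ Type w) (s : Set (Σ A, F.obj A)) : Subfunctor F where
  obj A := {x | ∃ p ∈ s, ∃ u : p.1 ⟶ A, F.map u p.2 = x}
  map := by
    rintro A B f _ ⟨p, hp, u, rfl⟩
    exact ⟨p, hp, u ≫ f, by simp⟩

lemma generatedBy_mono : Monotone (generatedBy F) :=
  fun _ _ h _ _ ⟨p, hp, hu⟩ ↦ ⟨p, h hp, hu⟩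

lemma mem_generatedBy {s : Set (Σ A, F.obj A)} {p : Σ A, F.obj A} (hp : p ∈ s) :
    p.2 ∈ (generatedBy F s).obj p.1 :=
  ⟨p, hp, 𝟙 _, by simp⟩

/-- The diagram of the finitely generated subfunctors of `F`, indexed by finite sets of
elements of `F`. -/
@[simps]
def finitelyGeneratedDiagram (F : C ⥤ Type w) : Finset (Σ A, F.obj A) ⥤ C ⥤ Type w where
  obj s := (generatedBy F s).toFunctor
  map f := homOfLe (generatedBy_mono (Finset.coe_subset.2 (leOfHom f)))

/-- The cocone of inclusions of the finitely generated subfunctors of `F` into `F`. -/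
@[simps]
def finitelyGeneratedCocone (F : C ⥤ Type w) : Cocone (finitelyGeneratedDiagram F) where
  pt := F
  ι := { app s := (generatedBy F s).ι }

/-- Every functor to types is the directed union of its finitely generated subfunctors. -/
noncomputable def isColimitFinitelyGeneratedCocone (F : C ⥤ Type w) :
    IsColimit (finitelyGeneratedCocone F) := by
  classical
  refine evaluationJointlyReflectsColimits _ fun A ↦
    Types.FilteredColimit.isColimitOf' _ _ (fun x ↦ ?_) (fun s x y h ↦ ?_)
  · exact ⟨{⟨A, x⟩}, ⟨x, mem_generatedBy (p := ⟨A, x⟩)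
      (Finset.mem_coe.2 (Finset.mem_singleton_self _))⟩, rfl⟩
  · exact ⟨s, 𝟙 s, congrArg _ (Subtype.ext h)⟩

end Subfunctor

open Subfunctor

variable {C : Type u} [Category.{v} C]

/-- A functor to types whose hom-functor preserves the directed union of its finitely generated
subfunctors is finitely generated. -/
lemma exists_finset_generatedBy_eq_top (F : C ⥤ Type w)
    [PreservesColimit (finitelyGeneratedDiagram F) (coyoneda.obj (Opposite.op F))] :
    ∃ s : Finset (Σ A, F.obj A), generatedBy F s = ⊤ := by
  obtain ⟨s, f, hf⟩ : ∃ (s : Finset (Σ A, F.obj A)) (f : F ⟶ (generatedBy F s).toFunctor),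
      f ≫ (generatedBy F s).ι = 𝟙 F := Types.jointly_surjective_of_isColimit
    (isColimitOfPreserves (coyoneda.obj (Opposite.op F)) (isColimitFinitelyGeneratedCocone F))
    (𝟙 F)
  refine ⟨s, top_le_iff.1 fun A x _ ↦ ?_⟩
  have hx : (f.app A x).1 = x := by
    simpa using ConcreteCategory.congr_hom (NatTrans.congr_app hf A) x
  exact hx ▸ (f.app A x).2

lemma exists_generator {F : C ⥤ Type w} {s : Finset (Σ A, F.obj A)}
    (hs : generatedBy F s = ⊤) {A : C} (x : F.obj A) :
    ∃ (p : s) (u : p.1.1 ⟶ A), F.map u p.1.2 = x := by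
  have hx : x ∈ (generatedBy F s).obj A := by simp [hs]
  obtain ⟨p, hp, u, hu⟩ := hx
  exact ⟨⟨p, hp⟩, u, hu⟩

lemma exists_finset_generatedBy_eq_top_of_epi {F G : C ⥤ Type w} (q : F ⟶ G) [Epi q]
    (hF : ∃ s : Finset (Σ A, F.obj A), generatedBy F s = ⊤) :
    ∃ s : Finset (Σ A, G.obj A), generatedBy G s = ⊤ := by
  classical
  obtain ⟨s, hs⟩ := hF
  refine ⟨s.image fun p ↦ ⟨p.1, q.app p.1 p.2⟩, top_le_iff.1 fun A y _ ↦ ?_⟩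
  obtain ⟨x, rfl⟩ := (epi_iff_surjective (q.app A)).1 inferInstance y
  obtain ⟨p, u, rfl⟩ := exists_generator hs x
  exact ⟨⟨p.1.1, q.app _ p.1.2⟩, by simpa using ⟨p.1.1, p.1.2, p.2, rfl, HEq.rfl⟩, u,
    (NatTrans.naturality_apply q u p.1.2).symm⟩

section Extend

variable {F G : C ⥤ Type w} {s : Finset (Σ A, F.obj A)}

lemma hom_ext_of_generatedBy_eq_top (hs : generatedBy F s = ⊤) {f g : F ⟶ G}
    (h : ∀ p : s, f.app p.1.1 p.1.2 = g.app p.1.1 p.1.2) : f = g := by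
  ext A x
  obtain ⟨p, u, rfl⟩ := exists_generator hs x
  change f.app A _ = g.app A _
  rw [NatTrans.naturality_apply, NatTrans.naturality_apply, h]

/-- A choice of values on generators respecting all the relations between the generators extends
to a natural transformation. -/
lemma exists_hom_of_generatedBy_eq_top (hs : generatedBy F s = ⊤) (z : ∀ p : s, G.obj p.1.1)
    (hz : ∀ (p p' : s) (A : C) (u : p.1.1 ⟶ A) (u' : p'.1.1 ⟶ A),
      F.map u p.1.2 = F.map u' p'.1.2 → G.map u (z p) = G.map u' (z p')) :
    ∃ f : F ⟶ G, ∀ p : s, f.app p.1.1 p.1.2 = z p := by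
  choose p u hu using fun (A : C) (x : F.obj A) ↦ exists_generator hs x
  refine ⟨{ app A := ↾fun x ↦ G.map (u A x) (z (p A x)), naturality A B k := ?_ }, fun r ↦ ?_⟩
  · ext x
    have := hz _ _ B (u B (F.map k x)) (u A x ≫ k) (by simp [hu])
    simpa using this
  · have := hz _ _ _ (u _ r.1.2) (𝟙 _) (by simp [hu])
    simpa using this

end Extend

lemma app_map_eq_app_map {F G H : C ⥤ Type w} {f : F ⟶ H} {g : G ⟶ H} {A A' B : C}
    {x : F.obj A} {x' : F.obj A'} {z : G.obj A} {z' : G.obj A'}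
    (h : g.app A z = f.app A x) (h' : g.app A' z' = f.app A' x') {u : A ⟶ B} {u' : A' ⟶ B}
    (hu : F.map u x = F.map u' x') : g.app B (G.map u z) = g.app B (G.map u' z') := by
  rw [NatTrans.naturality_apply, NatTrans.naturality_apply, h, h', ← NatTrans.naturality_apply,
    hu, NatTrans.naturality_apply]

section Filtered

variable {J : Type*} [Category* J] [IsFiltered J] {Z : J ⥤ C ⥤ Type w} {c : Cocone Z}
  {K : Type*} [Finite K] {A : K → C}

/-- Finitely many pairs of elements which agree in a pointwise filtered colimit of functors to
types agree at some common later stage. -/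
lemma exists_map_app_eq_of_finite
    (hc : ∀ A, IsColimit (((evaluation _ _).obj A).mapCocone c)) {i : J}
    (x y : ∀ k, (Z.obj i).obj (A k))
    (h : ∀ k, (c.ι.app i).app (A k) (x k) = (c.ι.app i).app (A k) (y k)) :
    ∃ (j : J) (f : i ⟶ j), ∀ k, (Z.map f).app (A k) (x k) = (Z.map f).app (A k) (y k) := by
  choose j f hf using fun k ↦
    (Types.FilteredColimit.isColimit_eq_iff' (hc (A k)) (x k) (y k)).1 (h k)
  replace hf (k : K) : (Z.map (f k)).app (A k) (x k) = (Z.map (f k)).app (A k) (y k) := hf k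
  obtain ⟨l, fl, g, hg⟩ := IsFiltered.wideSpan f
  exact ⟨l, fl, fun k ↦ by simp [← hg k, hf k]⟩

/-- Finitely many elements of a pointwise filtered colimit of functors to types lift to a common
stage. -/
lemma exists_lift_of_finite
    (hc : ∀ A, IsColimit (((evaluation _ _).obj A).mapCocone c))
    (x : ∀ k, c.pt.obj (A k)) :
    ∃ (j : J) (y : ∀ k, (Z.obj j).obj (A k)), ∀ k, (c.ι.app j).app (A k) (y k) = x k := by
  classical
  cases nonempty_fintype K
  choose j y hy using fun k ↦ Types.jointly_surjective_of_isColimit (hc (A k)) (x k)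
  replace hy (k : K) : (c.ι.app (j k)).app (A k) (y k) = x k := hy k
  obtain ⟨l, hl⟩ := IsFiltered.sup_objs_exists (Finset.univ.image j)
  have g (k : K) : j k ⟶ l := (hl (Finset.mem_image_of_mem j (Finset.mem_univ k))).some
  refine ⟨l, fun k ↦ (Z.map (g k)).app (A k) (y k), fun k ↦ ?_⟩
  rw [← hy k, ← c.w (g k)]
  rfl

end Filtered

end CategoryTheory

namespace FintypeCat

open Subfunctor

/-- A finite set, depending only on `A` and `A'`, through which suitable pairs of maps out of
`A` and `A'` factor; the boolean tells whether a point is added. -/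
abbrev cospanTarget (A A' : FintypeCat.{0}) (b : Bool) : FintypeCat.{0} :=
  of ((A.obj ⊕ A'.obj) ⊕ PLift (b = true))

/-- Every cospan of finite sets is fixed by an endomorphism of its apex that factors through one
of the two sets `cospanTarget A A' b`. -/
lemma exists_factorization {A A' B : FintypeCat.{0}} (u : A ⟶ B) (u' : A' ⟶ B) :
    ∃ (b : Bool) (r : B ⟶ cospanTarget A A' b) (i : cospanTarget A A' b ⟶ B),
      u ≫ r ≫ i = u ∧ u' ≫ r ≫ i = u' := by
  obtain ⟨b, hb, ⟨i₀⟩⟩ : ∃ b : Bool, (Nonempty B → b = true) ∧ Nonempty (PLift (b = true) → B) := by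
    by_cases h : Nonempty B
    · exact ⟨true, fun _ ↦ rfl, ⟨fun _ ↦ h.some⟩⟩
    · exact ⟨false, fun h' ↦ (h h').elim, ⟨fun h' ↦ by simpa using h'.down⟩⟩
  let i : (A.obj ⊕ A'.obj) ⊕ PLift (b = true) → B := Sum.elim (Sum.elim u u') i₀
  have hr (y : B) : ∃ x, y ∈ Set.range i → i x = y := by
    by_cases h : y ∈ Set.range i
    · exact ⟨h.choose, fun _ ↦ h.choose_spec⟩
    · exact ⟨Sum.inr ⟨hb ⟨y⟩⟩, fun h' ↦ (h h').elim⟩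
  choose r hr using hr
  refine ⟨b, homMk r, homMk i, ?_, ?_⟩
  · ext x
    exact hr _ ⟨Sum.inl (Sum.inl x), rfl⟩
  · ext x
    exact hr _ ⟨Sum.inl (Sum.inr x), rfl⟩

/-- For functors on finite sets, the relations between elements at `A` and `A'` are determined by
those holding in the sets `cospanTarget A A' b`. -/
lemma map_eq_map_of_cospanTarget {F G : FintypeCat.{0} ⥤ Type} {A A' : FintypeCat.{0}}
    {x : F.obj A} {x' : F.obj A'} {z : G.obj A} {z' : G.obj A'}
    (h : ∀ (b : Bool) (v : A ⟶ cospanTarget A A' b) (v' : A' ⟶ cospanTarget A A' b),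
      F.map v x = F.map v' x' → G.map v z = G.map v' z')
    {B : FintypeCat.{0}} (u : A ⟶ B) (u' : A' ⟶ B) (hu : F.map u x = F.map u' x') :
    G.map u z = G.map u' z' := by
  obtain ⟨b, r, i, hi, hi'⟩ := exists_factorization u u'
  have := h b (u ≫ r) (u' ≫ r) (by simp [hu])
  rw [← hi, ← hi', ← Category.assoc, ← Category.assoc, Functor.map_comp_apply,
    Functor.map_comp_apply _ (u' ≫ r), this]

instance (A B : FintypeCat.{0}) : Finite (A ⟶ B) :=
  Finite.of_injective (fun (f : A ⟶ B) (x : A) ↦ f x) fun _ _ h ↦ hom_ext _ _ (congrFun h)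

/-- Finitely generated functors on finite sets are finitely presentable. -/
lemma finitelyPresentable_of_generatedBy_eq_top {Y : FintypeCat.{0} ⥤ Type}
    {s : Finset (Σ A, Y.obj A)} (hs : generatedBy Y s = ⊤) : FinitelyPresentable Y := by
  refine ⟨fun J _ _ ↦ ⟨fun {Z} ↦ ⟨fun {c} hc ↦ ⟨?_⟩⟩⟩⟩
  have hc' (A : FintypeCat.{0}) : IsColimit (((evaluation _ _).obj A).mapCocone c) :=
    isColimitOfPreserves _ hc
  refine Types.FilteredColimit.isColimitOf' _ _ (fun (f : Y ⟶ c.pt) ↦ ?_)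
    (fun i (f : Y ⟶ Z.obj i) (g : Y ⟶ Z.obj i) (h : f ≫ c.ι.app i = g ≫ c.ι.app i) ↦ ?_)
  · obtain ⟨i, z, hz⟩ := exists_lift_of_finite hc' (fun p : s ↦ f.app p.1.1 p.1.2)
    let Relation : Type 1 := Σ (p : s) (p' : s) (b : Bool),
      { v : (p.1.1 ⟶ cospanTarget p.1.1 p'.1.1 b) × (p'.1.1 ⟶ cospanTarget p.1.1 p'.1.1 b) //
        Y.map v.1 p.1.2 = Y.map v.2 p'.1.2 }
    have : Finite Relation := inferInstance
    obtain ⟨j, k, hk⟩ := exists_map_app_eq_of_finite hc' (i := i) (K := Relation)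
      (A := fun t ↦ cospanTarget t.1.1.1 t.2.1.1.1 t.2.2.1)
      (fun t ↦ (Z.obj i).map t.2.2.2.1.1 (z t.1)) (fun t ↦ (Z.obj i).map t.2.2.2.1.2 (z t.2.1))
      (fun ⟨p, p', b, v, hv⟩ ↦ app_map_eq_app_map (hz p) (hz p') hv)
    obtain ⟨g, hg⟩ := exists_hom_of_generatedBy_eq_top (G := Z.obj j) hs
      (fun p ↦ (Z.map k).app _ (z p))
      (fun p p' A u u' ↦ map_eq_map_of_cospanTarget (fun b v v' hv ↦ by
        rw [← NatTrans.naturality_apply, ← NatTrans.naturality_apply]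
        exact hk ⟨p, p', b, (v, v'), hv⟩) u u')
    refine ⟨j, g, hom_ext_of_generatedBy_eq_top (G := c.pt) hs fun p ↦ ?_⟩
    change _ = (c.ι.app j).app _ (g.app _ _)
    rw [hg, ← hz, ← c.w k]
    rfl
  · obtain ⟨j, k, hk⟩ := exists_map_app_eq_of_finite hc' (i := i)
      (fun p : s ↦ f.app _ p.1.2) (fun p ↦ g.app _ p.1.2)
      fun p ↦ ConcreteCategory.congr_hom (NatTrans.congr_app h p.1.1) p.1.2
    exact ⟨j, k, hom_ext_of_generatedBy_eq_top (G := Z.obj j) hs hk⟩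

end FintypeCat

/-- If `X` is a finitely presentable presheaf and `q : X ⟶ Y` is an epimorphism in
`𝔽 ⥤ Type`, then `Y` is finitely presentable. -/
theorem finitelyPresentable_of_epi (X Y : FintypeCat.{0} ⥤ Type)
    (hX : FinitelyPresentable X) (q : X ⟶ Y) (hq : Epi q) :
    FinitelyPresentable Y := by
  have : PreservesColimit (Subfunctor.finitelyGeneratedDiagram X)
      (coyoneda.obj (Opposite.op X)) :=
    (hX.preserves_filtered_colimits _).preservesColimit
  obtain ⟨s, hs⟩ := exists_finset_generatedBy_eq_top_of_epi q (exists_finset_generatedBy_eq_top X)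
  exact FintypeCat.finitelyPresentable_of_generatedBy_eq_top hs
end

section
/- Let C be a category with binary coproducts, H : C ⥤ C an endofunctor, and X an object of C. If (T, c) is a terminal coalgebra for the endofunctor Y ↦ H Y ⨿ X, then c is an isomorphism (Lambek), and writing its inverse as [τ, η] with τ : H T ⟶ T and η : X ⟶ T, the H-algebra (T, τ) is completely iterative: for every object W and every morphism e : W ⟶ H W ⨿ T there exists a unique morphism e† : W ⟶ T such that e† = [τ, 𝟙_T] ∘ (H e† ⨿ 𝟙_T) ∘ e. -/
open CategoryTheory CategoryTheory.Limits

universe v u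

variable {C : Type u} [Category.{v} C] [HasBinaryCoproducts C]

/-- The endofunctor `Y ↦ H Y ⨿ X`. -/
noncomputable def coprodWith (H : C ⥤ C) (X : C) : C ⥤ C where
  obj Y := H.obj Y ⨿ X
  map f := coprod.map (H.map f) (𝟙 X)
  map_id := by intro Y; simp
  map_comp := by intro Y Y' Y'' f g; simp [coprod.map_map]

/-- The coalgebra structure on `W ⨿ T` for `Y ↦ H Y ⨿ X` obtained from a flat equation morphism
`e : W ⟶ H W ⨿ T` and a coalgebra structure `c` on `T`. -/
noncomputable def flatEquationStr {H : C ⥤ C} {X T W : C} (c : T ⟶ H.obj T ⨿ X)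
    (e : W ⟶ H.obj W ⨿ T) : W ⨿ T ⟶ H.obj (W ⨿ T) ⨿ X :=
  coprod.desc
    (e ≫ coprod.desc (H.map coprod.inl ≫ coprod.inl) (c ≫ coprod.map (H.map coprod.inr) (𝟙 X)))
    (c ≫ coprod.map (H.map coprod.inr) (𝟙 X))

/-- A morphism `s` solves `e` in the algebra `inl ≫ c⁻¹` iff it satisfies the corresponding
equation on the coalgebra side. -/
theorem solution_iff_comp_str {H : C ⥤ C} {X T W : C} (c : T ⟶ H.obj T ⨿ X)
    (cinv : H.obj T ⨿ X ⟶ T) (h₁ : c ≫ cinv = 𝟙 T) (h₂ : cinv ≫ c = 𝟙 (H.obj T ⨿ X))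
    (e : W ⟶ H.obj W ⨿ T) (s : W ⟶ T) :
    s = e ≫ coprod.map (H.map s) (𝟙 T) ≫ coprod.desc (coprod.inl ≫ cinv) (𝟙 T) ↔
      s ≫ c = e ≫ coprod.desc (H.map s ≫ coprod.inl) c := by
  have key : e ≫ coprod.map (H.map s) (𝟙 T) ≫ coprod.desc (coprod.inl ≫ cinv) (𝟙 T) =
      (e ≫ coprod.desc (H.map s ≫ coprod.inl) c) ≫ cinv := by
    simp [h₁]
  rw [key]
  constructor
  · intro h
    conv_lhs => rw [h]
    rw [Category.assoc, h₂, Category.comp_id]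
  · intro h
    rw [← h, Category.assoc, h₁, Category.comp_id]

/-- The copairing `[s, 𝟙]` of a solution is a coalgebra homomorphism out of `W ⨿ T`. -/
theorem flatEquationStr_comp_map_desc {H : C ⥤ C} {X T W : C} (c : T ⟶ H.obj T ⨿ X)
    (e : W ⟶ H.obj W ⨿ T) (s : W ⟶ T)
    (hs : s ≫ c = e ≫ coprod.desc (H.map s ≫ coprod.inl) c) :
    flatEquationStr c e ≫ coprod.map (H.map (coprod.desc s (𝟙 T))) (𝟙 X) =
      coprod.desc s (𝟙 T) ≫ c := by
  apply coprod.hom_ext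
  · simp [flatEquationStr, hs, coprod.inl_desc, coprod.inr_desc, ← Functor.map_comp,
      ← Functor.map_comp_assoc]
  · simp [flatEquationStr, coprod.inr_desc, ← Functor.map_comp]

/-- If a coalgebra homomorphism `f` out of `W ⨿ T` restricts to the identity on `T`, then its
restriction to `W` is a solution. -/
theorem inl_comp_str_of_hom {H : C ⥤ C} {X T W : C} (c : T ⟶ H.obj T ⨿ X)
    (e : W ⟶ H.obj W ⨿ T) (f : W ⨿ T ⟶ T)
    (hf : flatEquationStr c e ≫ coprod.map (H.map f) (𝟙 X) = f ≫ c)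
    (hinr : coprod.inr ≫ f = 𝟙 T) :
    (coprod.inl ≫ f) ≫ c = e ≫ coprod.desc (H.map (coprod.inl ≫ f) ≫ coprod.inl) c := by
  rw [Category.assoc, ← hf]
  simp [flatEquationStr, coprod.inl_desc, ← Functor.map_comp, ← Functor.map_comp_assoc, hinr]

/-- If `(T, c)` is a terminal coalgebra for `Y ↦ H Y ⨿ X`, then `c` is an isomorphism
(Lambek), and writing its inverse as `[τ, η]` with `τ : H T ⟶ T` and `η : X ⟶ T`, the
`H`-algebra `(T, τ)` is completely iterative: every flat equation morphism
`e : W ⟶ H W ⨿ T` has a unique solution `e† : W ⟶ T`, i.e. a unique morphism with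
`e† = [τ, 𝟙] ∘ (H e† ⨿ 𝟙) ∘ e`. -/
theorem terminal_coalgebra_gives_completely_iterative_algebra (H : C ⥤ C) (X : C)
    (T : Endofunctor.Coalgebra (coprodWith H X)) (hT : IsTerminal T) :
    ∃ cinv : H.obj T.V ⨿ X ⟶ T.V,
      T.str ≫ cinv = 𝟙 T.V ∧ cinv ≫ T.str = 𝟙 (H.obj T.V ⨿ X) ∧
      ∀ (W : C) (e : W ⟶ H.obj W ⨿ T.V), ∃! s : W ⟶ T.V,
        s = e ≫ coprod.map (H.map s) (𝟙 T.V) ≫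
              coprod.desc (coprod.inl ≫ cinv) (𝟙 T.V) := by
  refine ⟨Endofunctor.Coalgebra.Terminal.strInv hT,
    Endofunctor.Coalgebra.Terminal.right_inv hT, Endofunctor.Coalgebra.Terminal.left_inv hT,
    fun W e => ?_⟩
  have hsol := solution_iff_comp_str (H := H) (X := X) T.str
    (Endofunctor.Coalgebra.Terminal.strInv hT)
    (Endofunctor.Coalgebra.Terminal.right_inv hT) (Endofunctor.Coalgebra.Terminal.left_inv hT) e
  let S : Endofunctor.Coalgebra (coprodWith H X) := ⟨W ⨿ T.V, flatEquationStr T.str e⟩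
  let f : S ⟶ T := hT.from S
  let i : T ⟶ S :=
    { f := (coprod.inr : T.V ⟶ W ⨿ T.V)
      h := (coprod.inr_desc _ _).symm }
  have hinr : (coprod.inr : T.V ⟶ W ⨿ T.V) ≫ f.f = 𝟙 T.V :=
    congrArg Endofunctor.Coalgebra.Hom.f (hT.hom_ext (i ≫ f) (𝟙 T))
  refine ⟨(coprod.inl : W ⟶ W ⨿ T.V) ≫ f.f,
    (hsol _).2 (inl_comp_str_of_hom T.str e f.f f.h hinr), fun s hs => ?_⟩
  let g : S ⟶ T :=
    { f := coprod.desc s (𝟙 T.V)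
      h := flatEquationStr_comp_map_desc T.str e s ((hsol s).1 hs) }
  have hgf : coprod.desc s (𝟙 T.V) = f.f :=
    congrArg Endofunctor.Coalgebra.Hom.f (hT.hom_ext g f)
  rw [← hgf, coprod.inl_desc]
end
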